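/- Let P ⊂ R^n be an isotropic polytope such that every facet F of P satisfies E[||X||^2 X] = (n+2) E[X] for X uniform on F, and let G be an affine reflector of P (a ridge whose two containing facets F_1, F_2 are exchanged by an affine map fixing G pointwise). Then the affine map realizing the reflector is the orthogonal reflection across the linear hyperplane spanned by G: writing lin G = e_n^⊥ and the map as the linear map A = [e_1,...,e_{n-1}, v], one has v = -e_n. -/

import Mathlib

open MeasureTheory

lemma avg_param (n : ℕ) (L : (Fin (n + 1) → ℝ) →ₗ[ℝ] (Fin (n + 2) → ℝ))
    (hL : Function.Injective L) (p : Fin (n + 2) → ℝ) (K : Set (Fin (n + 1) → ℝ))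
    (g : (Fin (n + 2) → ℝ) → ℝ) :
    (⨍ x in (fun k => p + L k) '' K, g x ∂(μH[(n : ℝ) + 1])) = ⨍ k in K, g (p + L k) := by
  set φ : (Fin (n + 1) → ℝ) → (Fin (n + 2) → ℝ) := fun k => p + L k with hφ
  have hdim : ((n : ℝ) + 1) = ((Fintype.card (Fin (n + 1)) : ℕ) : ℝ) := by simp
  have hvol : (μH[(n : ℝ) + 1] : Measure (Fin (n + 1) → ℝ)) = volume := by
    rw [hdim]; exact hausdorffMeasure_pi_real
  have hd0 : (0 : ℝ) ≤ (n : ℝ) + 1 := by positivity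
  obtain ⟨C, hC0, hC⟩ := L.exists_antilipschitzWith (LinearMap.ker_eq_bot.2 hL)
  have hLip := (LinearMap.toContinuousLinearMap L).lipschitz
  set C' := ‖LinearMap.toContinuousLinearMap L‖₊
  have hφa : AntilipschitzWith C φ := by
    intro x y
    have := hC x y
    simpa [φ] using this
  have hφl : LipschitzWith C' φ := by
    intro x y
    have := hLip x y
    simpa [φ] using this
  have hemb : MeasurableEmbedding φ :=
    (hφa.isClosedEmbedding hφl.uniformContinuous).measurableEmbedding
  set ν := (μH[(n : ℝ) + 1] : Measure (Fin (n + 2) → ℝ)).comap φ with hν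
  have hνa : ∀ s, ν s = μH[(n : ℝ) + 1] (φ '' s) := fun s => hemb.comap_apply _ s
  have hhaar : ν.IsAddHaarMeasure := by
    have i1 : IsFiniteMeasureOnCompacts ν := ⟨fun k hk => by
      rw [hνa]
      refine (hφl.hausdorffMeasure_image_le hd0 k).trans_lt ?_
      rw [hvol]
      exact ENNReal.mul_lt_top (ENNReal.rpow_lt_top_of_nonneg hd0 ENNReal.coe_ne_top)
        hk.measure_lt_top⟩
    have i2 : ν.IsAddLeftInvariant := by
      refine ⟨fun a => ?_⟩
      ext s hs
      rw [Measure.map_apply (measurable_const_add a) hs, hνa, hνa]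
      have : φ '' s = (fun x => L a + x) '' (φ '' ((fun x => a + x) ⁻¹' s)) := by
        ext y
        simp only [Set.mem_image, Set.mem_preimage, exists_exists_and_eq_and, φ]
        constructor
        · rintro ⟨x, hx, rfl⟩
          refine ⟨x - a, by simpa using hx, ?_⟩
          rw [map_sub]; abel
        · rintro ⟨x, hx, rfl⟩
          refine ⟨a + x, hx, ?_⟩
          rw [map_add]; abel
      rw [this]
      exact ((isometry_add_left (L a)).hausdorffMeasure_image (Or.inl hd0) _).symm
    have i3 : ν.IsOpenPosMeasure := by
      refine ⟨fun U hU hne h0 => ?_⟩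
      rw [hνa] at h0
      have := hφa.le_hausdorffMeasure_image hd0 U
      rw [h0, hvol, mul_zero] at this
      exact (hU.measure_pos volume hne).ne' (le_antisymm this bot_le)
    exact { i1, i2, i3 with }
  have heq := Measure.isAddLeftInvariant_eq_smul ν (volume : Measure (Fin (n + 1) → ℝ))
  set c := Measure.addHaarScalarFactor ν (volume : Measure (Fin (n + 1) → ℝ)) with hc
  have hc0 : c ≠ 0 := (Measure.addHaarScalarFactor_pos_of_isAddHaarMeasure _ _).ne'
  have hmap : ν.map φ = (μH[(n : ℝ) + 1]).restrict (Set.range φ) := hemb.map_comap _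
  have hres : (μH[(n : ℝ) + 1]).restrict (φ '' K) = (ν.restrict K).map φ := by
    have h1 := hemb.restrict_map ν (φ '' K)
    rw [Set.preimage_image_eq _ hemb.injective, hmap, Measure.restrict_restrict_of_subset (Set.image_subset_range _ _)] at h1
    exact h1
  rw [setAverage_eq, setAverage_eq, hres, hemb.integral_map, measureReal_def, ← hνa, heq]
  rw [Measure.restrict_smul, integral_smul_nnreal_measure, measureReal_def, Measure.smul_apply]
  simp only [ENNReal.smul_def, smul_eq_mul, ENNReal.toReal_mul, ENNReal.coe_toReal, NNReal.smul_def]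
  have : (c : ℝ) ≠ 0 := by exact_mod_cast hc0
  by_cases h : (volume K).toReal = 0
  · simp [h]
  · field_simp
    rfl

lemma key_integral (n : ℕ) (K : Set (Fin (n + 1) → ℝ)) (hK : IsCompact K)
    (X Y : (Fin (n + 1) → ℝ) → Fin (n + 2) → ℝ) (hX : Continuous X) (hY : Continuous Y)
    (w : Fin (n + 2) → ℝ) (l : Fin (n + 2)) (c : ℝ)
    (hYX : ∀ k j, Y k j = X k j + X k l * w j) (hw : 1 + w l ≠ 0)
    (H1 : ∀ i, ∫ k in K, (∑ j, X k j ^ 2) * X k i = c * ∫ k in K, X k i)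
    (H2 : ∀ i, ∫ k in K, (∑ j, Y k j ^ 2) * Y k i = c * ∫ k in K, Y k i) :
    ∫ k in K, X k l * (∑ j, (X k j + Y k j) * w j) ^ 2 = 0 := by
  have hI : ∀ g : (Fin (n + 1) → ℝ) → ℝ, Continuous g → Integrable g (volume.restrict K) :=
    fun g hg => hg.continuousOn.integrableOn_compact hK
  have cX : ∀ i, Continuous fun k => X k i := fun i => (continuous_apply i).comp hX
  have cY : ∀ i, Continuous fun k => Y k i := fun i => (continuous_apply i).comp hY
  have cS : Continuous fun k => ∑ j, X k j ^ 2 := by fun_prop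
  have cT : Continuous fun k => ∑ j, Y k j ^ 2 := by fun_prop
  have hB : ∫ k in K, (∑ j, Y k j ^ 2) * X k l = c * ∫ k in K, X k l := by
    have h := H2 l
    have e : ∀ k, Y k l = (1 + w l) * X k l := fun k => by rw [hYX]; ring
    have e1 : ∀ k, (∑ j, Y k j ^ 2) * Y k l = (1 + w l) * ((∑ j, Y k j ^ 2) * X k l) :=
      fun k => by rw [e]; ring
    simp_rw [e1] at h
    simp_rw [e] at h
    rw [integral_const_mul, integral_const_mul] at h
    apply mul_left_cancel₀ hw
    linarith
  have hM : ∀ i, ∫ k in K, Y k i = (∫ k in K, X k i) + w i * ∫ k in K, X k l := fun i => by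
    rw [← integral_const_mul, ← integral_add (hI _ (by fun_prop)) (hI _ (by fun_prop))]
    congr 1; ext k; rw [hYX]; ring
  have hz : ∀ i, ∫ k in K, ((∑ j, Y k j ^ 2) - ∑ j, X k j ^ 2) * (X k i + Y k i) = 0 := by
    intro i
    have e : ∀ k, ((∑ j, Y k j ^ 2) - ∑ j, X k j ^ 2) * (X k i + Y k i)
        = 2 * ((∑ j, Y k j ^ 2) * Y k i) - w i * ((∑ j, Y k j ^ 2) * X k l)
          - 2 * ((∑ j, X k j ^ 2) * X k i) - w i * ((∑ j, X k j ^ 2) * X k l) := fun k => by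
      have := hYX k i
      have h2 : X k i = Y k i - X k l * w i := by linarith
      have : ∀ S T : ℝ, (T - S) * (X k i + Y k i) = 2 * (T * Y k i) - w i * (T * X k l)
        - 2 * (S * X k i) - w i * (S * X k l) := by
        intro S T; rw [hYX k i]; ring
      exact this _ _
    simp_rw [e]
    rw [integral_sub (hI _ (by fun_prop)) (hI _ (by fun_prop)),
      integral_sub (hI _ (by fun_prop)) (hI _ (by fun_prop)),
      integral_sub (hI _ (by fun_prop)) (hI _ (by fun_prop)),
      integral_const_mul, integral_const_mul, integral_const_mul, integral_const_mul,
      H1, H1, H2, hB, hM]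
    ring
  have e : ∀ k, X k l * (∑ j, (X k j + Y k j) * w j) ^ 2
      = ∑ i, w i * (((∑ j, Y k j ^ 2) - ∑ j, X k j ^ 2) * (X k i + Y k i)) := by
    intro k
    have h1 : (∑ j, Y k j ^ 2) - ∑ j, X k j ^ 2 = X k l * ∑ j, (X k j + Y k j) * w j := by
      rw [← Finset.sum_sub_distrib, Finset.mul_sum]
      refine Finset.sum_congr rfl fun j _ => ?_
      rw [hYX]; ring
    rw [h1, sq, ← mul_assoc]
    conv_lhs => rw [Finset.mul_sum]
    exact Finset.sum_congr rfl fun j _ => by ring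
  simp_rw [e]
  rw [integral_finsetSum _ (fun i _ => hI _ (by fun_prop))]
  refine Finset.sum_eq_zero fun i _ => ?_
  rw [integral_const_mul, hz, mul_zero]
/-- First-order conditions force an affine reflector to be a Euclidean reflector.
Let `P ⊂ ℝ^{n+2}` be an isotropic polytope all of whose facets satisfy
`E[‖X‖² X] = (dim + 2) E[X]`, and let `G = F₁ ∩ F₂` be a ridge with
`lin G = eₙ^⊥`, exchanged by a linear map `f` fixing `G` pointwise and with
`F₁` in the upper halfspace. Then `f eₙ = -eₙ`. -/
theorem affine_reflector_is_euclidean (n : ℕ)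
    (s : Finset (Fin (n + 2) → ℝ)) (P : Set (Fin (n + 2) → ℝ))
    (hP : P = convexHull ℝ (s : Set (Fin (n + 2) → ℝ)))
    (hint : (interior P).Nonempty)
    (hcentroid : ∀ i, (⨍ x in P, x i) = 0)
    (hiso : ∀ i j, (⨍ x in P, x i * x j) = if i = j then 1 else 0)
    (hfacet : ∀ F : Set (Fin (n + 2) → ℝ), IsExposed ℝ P F → F ≠ P →
      Module.finrank ℝ (vectorSpan ℝ F) = n + 1 →
      ∀ i, (⨍ x in F, (∑ k, x k ^ 2) * x i ∂(μH[(n : ℝ) + 1]))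
        = ((n : ℝ) + 2 + 2) * ⨍ x in F, x i ∂(μH[(n : ℝ) + 1]))
    (G F₁ F₂ : Set (Fin (n + 2) → ℝ))
    (hF₁ : IsExposed ℝ P F₁) (hF₁p : F₁ ≠ P)
    (hF₁d : Module.finrank ℝ (vectorSpan ℝ F₁) = n + 1)
    (hF₂ : IsExposed ℝ P F₂) (hF₂p : F₂ ≠ P)
    (hF₂d : Module.finrank ℝ (vectorSpan ℝ F₂) = n + 1)
    (hne : F₁ ≠ F₂) (hG : G = F₁ ∩ F₂)
    (hGdim : Module.finrank ℝ (vectorSpan ℝ G) = n)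
    (hGspan : Submodule.span ℝ G =
      LinearMap.ker (LinearMap.proj (Fin.last (n + 1)) :
        (Fin (n + 2) → ℝ) →ₗ[ℝ] ℝ))
    (hside : ∀ x ∈ F₁, 0 ≤ x (Fin.last (n + 1)))
    (f : (Fin (n + 2) → ℝ) →ₗ[ℝ] (Fin (n + 2) → ℝ))
    (hf1 : f '' F₁ = F₂) (hf2 : ∀ x ∈ G, f x = x) :
    f (Pi.single (Fin.last (n + 1)) 1) = -(Pi.single (Fin.last (n + 1)) 1) := by
  classical
  set l : Fin (n + 2) := Fin.last (n + 1) with hl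
  set v := f (Pi.single l 1) with hv
  set w : Fin (n + 2) → ℝ := v - Pi.single l 1 with hw
  have hPc : IsCompact P := by rw [hP]; exact s.finite_toSet.isCompact_convexHull ℝ
  have hPconv : Convex ℝ P := by rw [hP]; exact convex_convexHull ℝ _
  -- `f` is the identity on the hyperplane
  have hfid : ∀ x : Fin (n + 2) → ℝ, x l = 0 → f x = x := by
    intro x hx
    have hx' : x ∈ Submodule.span ℝ G := by
      rw [hGspan]; simpa using hx
    induction hx' using Submodule.span_induction with
    | mem x h => exact hf2 x h
    | zero => simp
    | add x y hx1 hy1 hx2 hy2 =>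
      rw [hGspan] at hx1 hy1
      rw [map_add, hx2 (by simpa using hx1), hy2 (by simpa using hy1)]
    | smul a x hx1 hx2 =>
      rw [hGspan] at hx1
      rw [map_smul, hx2 (by simpa using hx1)]
  have hff : ∀ x, f x = x + x l • w := by
    intro x
    have h1 := hfid (x - x l • Pi.single l 1) (by simp)
    rw [map_sub, map_smul, ← hv] at h1
    rw [hw, smul_sub]
    rw [sub_eq_iff_eq_add] at h1
    rw [h1]; abel
  have hffj : ∀ x j, f x j = x j + x l * w j := by
    intro x j; rw [hff]; simp
  -- a point of `F₁` off the hyperplane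
  obtain ⟨x0, hx0, hx0l⟩ : ∃ x ∈ F₁, 0 < x l := by
    by_contra! hcon
    apply hne
    have : f '' F₁ = id '' F₁ := Set.image_congr fun x hx =>
      hfid x (le_antisymm (hcon x hx) (hside x hx))
    rw [← hf1, this, Set.image_id]
  have hGF₁ : G ⊆ F₁ := by rw [hG]; exact Set.inter_subset_left
  -- nondegeneracy
  have hwl : 1 + w l ≠ 0 := by
    intro h0
    have hF₂0 : ∀ y ∈ F₂, y l = 0 := by
      intro y hy
      rw [← hf1] at hy
      obtain ⟨x, hx, rfl⟩ := hy
      rw [hffj]; linear_combination x l * h0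
    have hle : vectorSpan ℝ F₂ ≤ LinearMap.ker (LinearMap.proj l : (Fin (n + 2) → ℝ) →ₗ[ℝ] ℝ) := by
      rw [vectorSpan_def, Submodule.span_le]
      rintro _ ⟨a, ha, b, hb, rfl⟩
      simp [hF₂0 a ha, hF₂0 b hb]
    have hker : Module.finrank ℝ (LinearMap.ker (LinearMap.proj l : (Fin (n + 2) → ℝ) →ₗ[ℝ] ℝ))
        = n + 1 := by
      have h1 := (LinearMap.proj l : (Fin (n + 2) → ℝ) →ₗ[ℝ] ℝ).finrank_range_add_finrank_ker
      rw [LinearMap.range_eq_top.2 (LinearMap.proj_surjective l)] at h1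
      simp at h1
      omega
    have hVeq := Submodule.eq_of_le_of_finrank_eq hle (hF₂d.trans hker.symm)
    have hy0 : f x0 ∈ F₂ := hf1 ▸ Set.mem_image_of_mem f hx0
    obtain ⟨u, hu⟩ := hF₂ ⟨_, hy0⟩
    have hu0 : ∀ x : Fin (n + 2) → ℝ, x l = 0 → u x = 0 := by
      intro x hx
      have hx' : x ∈ vectorSpan ℝ F₂ := by rw [hVeq]; simpa using hx
      have hle2 : vectorSpan ℝ F₂ ≤ LinearMap.ker (u : (Fin (n + 2) → ℝ) →ₗ[ℝ] ℝ) := by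
        rw [vectorSpan_def, Submodule.span_le]
        rintro _ ⟨a, ha, b, hb, rfl⟩
        rw [hu] at ha hb
        have := le_antisymm (ha.2 b hb.1) (hb.2 a ha.1)
        simp [this]
      simpa using hle2 hx'
    have hua : ∀ x, u x = x l * u (Pi.single l 1) := by
      intro x
      have h1 := hu0 (x - x l • Pi.single l 1) (by simp)
      rw [map_sub, map_smul, smul_eq_mul] at h1
      linarith
    set a := u (Pi.single l 1)
    have hPa : ∀ y ∈ P, y l * a ≤ 0 := by
      intro y hy
      have := hy0
      rw [hu] at this
      have h2 := this.2 y hy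
      rw [hua, hua (f x0), hF₂0 _ hy0] at h2
      simpa using h2
    have hx0P := hF₁.subset hx0
    have ha0 : a ≠ 0 := by
      intro ha
      apply hF₂p
      rw [hu]
      ext x
      simp only [Set.mem_ofPred_eq, hua, ha, mul_zero, le_refl, implies_true, and_true]
    have ha : a < 0 := lt_of_le_of_ne (by
      have := hPa _ hx0P
      by_contra! hpos
      nlinarith [mul_pos hx0l hpos]) ha0
    have hPnn : ∀ y ∈ P, 0 ≤ y l := by
      intro y hy
      by_contra! hneg
      nlinarith [hPa y hy, mul_pos_of_neg_of_neg hneg ha]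
    have hc := hcentroid l
    have hvol0 : volume.real P ≠ 0 := by
      rw [measureReal_def, ENNReal.toReal_ne_zero]
      exact ⟨(Measure.measure_pos_of_nonempty_interior _ hint).ne', hPc.measure_lt_top.ne⟩
    rw [setAverage_eq, smul_eq_mul, mul_eq_zero, or_iff_right (inv_ne_zero hvol0)] at hc
    have cc : Continuous fun x : Fin (n + 2) → ℝ => x l := continuous_apply l
    rw [integral_eq_zero_iff_of_nonneg_ae
      (ae_restrict_of_forall_mem hPc.isClosed.measurableSet hPnn)
      (cc.continuousOn.integrableOn_compact hPc)] at hc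
    have := Measure.eqOn_of_ae_eq hc cc.continuousOn continuousOn_const (by
      rw [hPconv.closure_interior_eq_closure_of_nonempty_interior hint]; exact subset_closure)
    exact hx0l.ne' (this hx0P)
  -- parametrization
  have e : (Fin (n + 1) → ℝ) ≃ₗ[ℝ] vectorSpan ℝ F₁ :=
    LinearEquiv.ofFinrankEq _ _ (by simp [hF₁d])
  set L : (Fin (n + 1) → ℝ) →ₗ[ℝ] (Fin (n + 2) → ℝ) :=
    (vectorSpan ℝ F₁).subtype ∘ₗ e.toLinearMap with hLdef
  have hLinj : Function.Injective L := Subtype.val_injective.comp e.injective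
  have hLrange : LinearMap.range L = vectorSpan ℝ F₁ := by
    rw [hLdef, LinearMap.range_comp, LinearEquiv.range, Submodule.map_top, Submodule.range_subtype]
  set φ : (Fin (n + 1) → ℝ) → (Fin (n + 2) → ℝ) := fun k => x0 + L k with hφ
  have hφc : Continuous φ := continuous_const.add L.continuous_of_finiteDimensional
  set K := φ ⁻¹' F₁ with hK
  have hφK : φ '' K = F₁ := by
    rw [hK, Set.image_preimage_eq_iff]
    intro x hx
    have : x - x0 ∈ LinearMap.range L := by
      rw [hLrange]; exact vsub_mem_vectorSpan ℝ hx hx0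
    obtain ⟨k, hk⟩ := this
    exact ⟨k, by simp [φ, hk]⟩
  have hF₁c := hF₁.isCompact hPc
  have hF₁conv := hF₁.convex hPconv
  have hKc : IsCompact K := by
    obtain ⟨C, hC0, hC⟩ := L.exists_antilipschitzWith (LinearMap.ker_eq_bot.2 hLinj)
    have hφa : AntilipschitzWith C φ := by
      intro x y
      simpa [φ] using hC x y
    refine Metric.isCompact_of_isClosed_isBounded (hF₁c.isClosed.preimage hφc) ?_
    exact hφa.isBounded_preimage hF₁c.isBounded
  have hKconv : Convex ℝ K := by
    intro a ha b hb p q hp hq hpq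
    have := hF₁conv ha hb hp hq hpq
    change x0 + L (p • a + q • b) ∈ F₁
    convert this using 1
    simp only [φ, map_add, map_smul, smul_add]
    have : x0 = p • x0 + q • x0 := by rw [← add_smul, hpq, one_smul]
    nth_rw 1 [this]; abel
  have h0K : (0 : Fin (n + 1) → ℝ) ∈ K := by simpa [hK, φ] using hx0
  have hspanmap : ∀ M : (Fin (n + 1) → ℝ) →ₗ[ℝ] (Fin (n + 2) → ℝ), ∀ p,
      vectorSpan ℝ ((fun k => p + M k) '' K) = (vectorSpan ℝ K).map M := by
    intro M p
    rw [vectorSpan_def, vectorSpan_def, Submodule.map_span]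
    congr 1
    ext y
    constructor
    · rintro ⟨_, ⟨a, ha, rfl⟩, _, ⟨b, hb, rfl⟩, rfl⟩
      exact ⟨a - b, ⟨a, ha, b, hb, rfl⟩, by simp⟩
    · rintro ⟨_, ⟨a, ha, b, hb, rfl⟩, rfl⟩
      exact ⟨_, ⟨a, ha, rfl⟩, _, ⟨b, hb, rfl⟩, by simp⟩
  have hKV : vectorSpan ℝ K = ⊤ := by
    have h1 := hspanmap L x0
    rw [show (fun k => x0 + L k) '' K = F₁ from hφK] at h1
    apply Submodule.eq_top_of_finrank_eq
    rw [← LinearEquiv.finrank_eq (Submodule.equivMapOfInjective L hLinj (vectorSpan ℝ K)).symm]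
    rw [← h1, hF₁d]; simp
  have hKint : (interior K).Nonempty := by
    rw [hKconv.interior_nonempty_iff_affineSpan_eq_top,
      AffineSubspace.affineSpan_eq_top_iff_vectorSpan_eq_top_of_nonempty ℝ _ _ ⟨0, h0K⟩]
    exact hKV
  have hL2 : (fun k => f x0 + (f ∘ₗ L) k) '' K = F₂ := by
    rw [← hf1, ← hφK, Set.image_image]
    refine Set.image_congr fun k _ => ?_
    simp [φ]
  have hL2inj : Function.Injective (f ∘ₗ L) := by
    have h1 := hspanmap (f ∘ₗ L) (f x0)
    rw [hL2, hKV, Submodule.map_top] at h1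
    have h2 := (f ∘ₗ L).finrank_range_add_finrank_ker
    rw [← h1, hF₂d] at h2
    simp at h2
    exact LinearMap.ker_eq_bot.1 h2
  have hvolK : volume.real K ≠ 0 := by
    rw [measureReal_def, ENNReal.toReal_ne_zero]
    exact ⟨(Measure.measure_pos_of_nonempty_interior _ hKint).ne', hKc.measure_lt_top.ne⟩
  have hfc : Continuous f := f.continuous_of_finiteDimensional
  have hcancel : ∀ a b c : ℝ, (volume.real K)⁻¹ • a = c * ((volume.real K)⁻¹ • b) → a = c * b := by
    intro a b c h
    simp only [smul_eq_mul] at h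
    field_simp at h
    exact h
  have hzero := key_integral n K hKc φ (fun k => f (φ k)) hφc (hfc.comp hφc) w l
    ((n : ℝ) + 2 + 2) (fun k j => hffj _ _) hwl
    (by
      intro i
      have h := hfacet F₁ hF₁ hF₁p hF₁d i
      rw [← hφK] at h
      rw [avg_param n L hLinj x0 K (fun x => (∑ k, x k ^ 2) * x i),
        avg_param n L hLinj x0 K (fun x => x i), setAverage_eq, setAverage_eq] at h
      exact hcancel _ _ _ h)
    (by
      intro i
      have h := hfacet F₂ hF₂ hF₂p hF₂d i
      rw [← hL2] at h
      rw [avg_param n _ hL2inj (f x0) K (fun x => (∑ k, x k ^ 2) * x i),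
        avg_param n _ hL2inj (f x0) K (fun x => x i), setAverage_eq, setAverage_eq] at h
      have hcan := hcancel _ _ _ h
      have e2 : ∀ k, f x0 + (f ∘ₗ L) k = f (φ k) := fun k => by simp [φ]
      simp_rw [e2] at hcan
      exact hcan)
  -- the linear functional q
  set q : (Fin (n + 2) → ℝ) → ℝ := fun x => ∑ j, (x j + f x j) * w j with hq
  have hqadd : ∀ x y, q (x + y) = q x + q y := by
    intro x y
    simp only [hq, ← Finset.sum_add_distrib, map_add, Pi.add_apply]
    exact Finset.sum_congr rfl fun j _ => by ring
  have hqsmul : ∀ (a : ℝ) x, q (a • x) = a * q x := by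
    intro a x
    simp only [hq, Finset.mul_sum, map_smul, Pi.smul_apply, smul_eq_mul]
    exact Finset.sum_congr rfl fun j _ => by ring
  have hqc : Continuous q := by
    have : ∀ j, Continuous fun x => f x j := fun j => (continuous_apply j).comp hfc
    simp only [hq]; fun_prop
  have cc : Continuous fun k => φ k l * q (φ k) ^ 2 :=
    (((continuous_apply l).comp hφc).mul ((hqc.comp hφc).pow 2))
  change ∫ k in K, φ k l * q (φ k) ^ 2 = 0 at hzero
  rw [integral_eq_zero_iff_of_nonneg_ae
      (ae_restrict_of_forall_mem hKc.isClosed.measurableSet fun k hk =>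
        mul_nonneg (hside _ hk) (sq_nonneg _))
      (cc.continuousOn.integrableOn_compact hKc)] at hzero
  have hKzero := Measure.eqOn_of_ae_eq hzero cc.continuousOn continuousOn_const (by
      rw [hKconv.closure_interior_eq_closure_of_nonempty_interior hKint]; exact subset_closure)
  have hF₁q : ∀ x ∈ F₁, 0 < x l → q x = 0 := by
    intro x hx hxl
    rw [← hφK] at hx
    obtain ⟨k, hk, rfl⟩ := hx
    have := hKzero hk
    simpa [hxl.ne'] using this
  have hGq : ∀ x ∈ F₁, q x = 0 := by
    intro x hx
    have hm := hF₁conv hx hx0 (a := 1 / 2) (b := 1 / 2) (by norm_num) (by norm_num) (by norm_num)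
    have h1 := hF₁q _ hm (by
      have := hside x hx
      simp only [Pi.add_apply, Pi.smul_apply, smul_eq_mul]
      linarith)
    rw [hqadd, hqsmul, hqsmul, hF₁q x0 hx0 hx0l] at h1
    linarith
  have hq0 : ∀ x : Fin (n + 2) → ℝ, x l = 0 → q x = 0 := by
    intro x hx
    have hx' : x ∈ Submodule.span ℝ G := by
      rw [hGspan]; simpa using hx
    clear hx
    induction hx' using Submodule.span_induction with
    | mem x h => exact hGq x (hGF₁ h)
    | zero => simp [hq]
    | add x y hx1 hy1 hx2 hy2 => rw [hqadd, hx2, hy2, add_zero]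
    | smul a x hx1 hx2 => rw [hqsmul, hx2, mul_zero]
  have hqe : q (Pi.single l 1) = 0 := by
    have h1 := hq0 (x0 - x0 l • Pi.single l 1) (by simp)
    rw [sub_eq_add_neg, ← neg_smul, hqadd, hqsmul, hF₁q x0 hx0 hx0l] at h1
    have : x0 l * q (Pi.single l 1) = 0 := by linarith
    exact (mul_eq_zero.1 this).resolve_left hx0l.ne'
  have hwj : ∀ j, j ≠ l → w j = 0 := by
    intro j hj
    have h1 := hq0 (Pi.single j 1) (by simp [Pi.single_apply, hj.symm])
    rw [hq] at h1
    simp only [hffj, Pi.single_apply, hj.symm, if_false, zero_mul, add_zero] at h1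
    simp [add_mul, Finset.sum_add_distrib] at h1
    linarith
  have hwl2 : w l = 0 ∨ w l = -2 := by
    rw [hq] at hqe
    simp only [hffj] at hqe
    rw [Finset.sum_eq_single l (fun j _ hj => by rw [hwj j hj, mul_zero]) (by simp)] at hqe
    simp at hqe
    rcases hqe with h | h
    · right; linarith
    · left; exact h
  have hwne : w l ≠ 0 := by
    intro h
    have hw0 : w = 0 := by
      ext j
      by_cases hj : j = l
      · rw [hj, h]; rfl
      · rw [hwj j hj]; rfl
    apply hne
    have : f '' F₁ = id '' F₁ := Set.image_congr fun x hx => by rw [hff, hw0]; simp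
    rw [← hf1, this, Set.image_id]
  have hwl3 := hwl2.resolve_left hwne
  have hvw : v = Pi.single l 1 + w := by rw [hw]; abel
  rw [hvw]
  ext j
  by_cases hj : j = l
  · subst hj; simp [hwl3]; norm_num
  · simp [hwj j hj, hj]
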